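/- Let n ≥ 2 and γ ∈ [1/2, n/2), and set s := n/2 + γ. Let v be a positive C² function on ℝ₊^{n+1} satisfying y²Δv − (n−1)y∂_y v + s(n−s)v = 0 on ℝ₊^{n+1}. Define w(x,y) := 1 − v(x,y)/y^{n−s} and ρ := v^{1/(n−s)}. Assume: (1) w belongs to H̃^{1,0}(ℝ₊^{n+1}) and lim_{y→0⁺} w(x,y) = 0 for every x ∈ ℝⁿ; (2) y|∇ρ| ≤ ρ on ℝ₊^{n+1} (for γ > 1/2 this is equivalent to the scalar curvature R*_s of the adapted metric g*_s being nonnegative, via R*_s = 2n(γ−1/2)(1−|∇*_s ρ|²)/ρ²). Then v(x,y) = y^{n−s} for all (x,y) ∈ ℝ₊^{n+1}, i.e. the adapted metric g*_s is the Euclidean metric. -/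

import Mathlib

open MeasureTheory Filter Set Topology
open scoped ENNReal NNReal

noncomputable section

/-- The Euclidean space `ℝ^{n+1}`. -/
abbrev E (n : ℕ) := EuclideanSpace ℝ (Fin (n + 1))

/-- The last coordinate `y` of a point `z = (x, y) ∈ ℝ^{n+1}`. -/
def ycoord {n : ℕ} (z : E n) : ℝ := z (Fin.last n)

/-- The open upper half-space `ℝ₊^{n+1}`. -/
def upperHalf (n : ℕ) : Set (E n) := {z | 0 < ycoord z}

/-- The open upper half-ball `B_r⁺`. -/
def Bplus (n : ℕ) (r : ℝ) : Set (E n) := {z | 0 < ycoord z ∧ ‖z‖ < r}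

/-- The upper hemisphere `(∂B_r)⁺`. -/
def sphPlus (n : ℕ) (r : ℝ) : Set (E n) := {z | 0 < ycoord z ∧ ‖z‖ = r}

/-- The point `(x, y) ∈ ℝ^{n+1}` built from `x ∈ ℝⁿ` and `y ∈ ℝ`. -/
def pt {n : ℕ} (x : EuclideanSpace ℝ (Fin n)) (y : ℝ) : E n :=
  (EuclideanSpace.equiv (Fin (n + 1)) ℝ).symm (Fin.snoc (fun i => x i) y)

/-- The unit vector `e_{n+1}` in the `y`-direction. -/
def eY (n : ℕ) : E n := EuclideanSpace.single (Fin.last n) (1 : ℝ)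

/-- The partial derivative `∂_y u` in the `y`-direction. -/
def partialY {n : ℕ} (u : E n → ℝ) (z : E n) : ℝ := fderiv ℝ u z (eY n)

/-- The Euclidean Laplacian `Δu = ∑ ∂²u/∂z_i²`. -/
def lap {n : ℕ} (u : E n → ℝ) (z : E n) : ℝ :=
  ∑ i : Fin (n + 1),
    fderiv ℝ (fun w => fderiv ℝ u w (EuclideanSpace.single i (1 : ℝ))) z
      (EuclideanSpace.single i (1 : ℝ))

/-- A C¹ function with compact support contained in `{z : ‖z‖ ≤ r, y > 0}`. -/
def IsTestFn (n : ℕ) (r : ℝ) (φ : E n → ℝ) : Prop :=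
  ContDiff ℝ 1 φ ∧ tsupport φ ⊆ {z : E n | ‖z‖ ≤ r ∧ 0 < ycoord z}

/-- The `y^a`-weighted Sobolev energy `∫_{B_r⁺} (|∇u|² + u²) y^a dz`. -/
def wInt (n : ℕ) (a : ℝ) (u : E n → ℝ) (r : ℝ) : ℝ≥0∞ :=
  ∫⁻ z in Bplus n r, ENNReal.ofReal ((‖gradient u z‖ ^ 2 + (u z) ^ 2) * (ycoord z) ^ a)

/-- Membership in `H^{1,a}(ℝ₊^{n+1})`: locally finite weighted Sobolev norm. -/
def memH1 (n : ℕ) (a : ℝ) (u : E n → ℝ) : Prop := ∀ r > 0, wInt n a u r < ⊤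

/-- Membership in `H̃^{1,a}(ℝ₊^{n+1})`: finite local weighted norm together with
approximability by C¹ functions compactly supported away from the boundary. -/
def memH1T (n : ℕ) (a : ℝ) (u : E n → ℝ) : Prop :=
  memH1 n a u ∧ ∀ r > 0, ∃ φ : ℕ → E n → ℝ, (∀ k, IsTestFn n r (φ k)) ∧
    Tendsto (fun k => wInt n a (fun z => u z - φ k z) r) atTop (nhds 0)


lemma second_test (g g' : ℝ → ℝ) (g2 t0 : ℝ) (h1 : ∀ᶠ t in 𝓝 t0, HasDerivAt g (g' t) t)
    (h2 : HasDerivAt g' g2 t0) (hmin : IsLocalMin g t0) : g' t0 = 0 ∧ 0 ≤ g2 := by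
  have h0 : g' t0 = 0 := hmin.hasDerivAt_eq_zero h1.self_of_nhds
  refine ⟨h0, ?_⟩
  by_contra hneg
  push Not at hneg
  have hd : deriv g =ᶠ[𝓝 t0] g' := h1.mono fun t ht => ht.deriv
  have hdn : deriv (fun t => - g t) =ᶠ[𝓝 t0] fun t => - g' t := by
    filter_upwards [h1] with t ht using ht.neg.deriv
  have hmax : IsLocalMin (fun t => - g t) t0 := by
    apply isLocalMin_of_deriv_deriv_pos
    · rw [hdn.deriv_eq, h2.fun_neg.deriv]; linarith
    · rw [hdn.self_of_nhds]; simp [h0]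
    · exact h1.self_of_nhds.continuousAt.neg
  have hconst : g =ᶠ[𝓝 t0] fun _ => g t0 := by
    filter_upwards [hmin, hmax] with t a b
    simp at b
    linarith
  have hz : g' =ᶠ[𝓝 t0] fun _ => 0 := by
    have := hconst.deriv
    filter_upwards [hd, this] with t a b
    rw [← a, b]; simp
  have := h2.deriv
  rw [hz.deriv_eq] at this
  simp at this
  linarith

lemma isOpen_upperHalf (n : ℕ) : IsOpen (upperHalf n) := by
  have : Continuous (fun z : E n => ycoord z) := by unfold ycoord; fun_prop
  exact isOpen_lt continuous_const this

lemma slice_derivs {n : ℕ} (v : E n → ℝ) (hC2 : ContDiffOn ℝ 2 v (upperHalf n)) (z : E n)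
    (hz : z ∈ upperHalf n) (e : E n) :
    (∀ t : ℝ, z + t • e ∈ upperHalf n →
      HasDerivAt (fun t : ℝ => v (z + t • e)) (fderiv ℝ v (z + t • e) e) t) ∧
    (∀ᶠ t : ℝ in 𝓝 0, z + t • e ∈ upperHalf n) ∧
    HasDerivAt (fun t : ℝ => fderiv ℝ v (z + t • e) e)
      (fderiv ℝ (fun w => fderiv ℝ v w e) z e) 0 := by
  have hl : ∀ t : ℝ, HasDerivAt (fun t : ℝ => z + t • e) e t := fun t => by
    simpa using ((hasDerivAt_id t).smul_const e).const_add z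
  refine ⟨fun t ht => ?_, ?_, ?_⟩
  · have hd : DifferentiableAt ℝ v (z + t • e) :=
      (hC2.contDiffAt ((isOpen_upperHalf n).mem_nhds ht)).differentiableAt (by norm_num)
    exact hd.hasFDerivAt.comp_hasDerivAt t (hl t)
  · have hc : ContinuousAt (fun t : ℝ => z + t • e) 0 := (hl 0).continuousAt
    apply hc.eventually_mem
    simpa using (isOpen_upperHalf n).mem_nhds hz
  · have hd : DifferentiableAt ℝ (fun w => fderiv ℝ v w e) z := by
      have h1 : ContDiffAt ℝ 1 (fderiv ℝ v) z :=
        (hC2.contDiffAt ((isOpen_upperHalf n).mem_nhds hz)).fderiv_right (by norm_num)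
      exact (h1.differentiableAt (by norm_num)).clm_apply (differentiableAt_const e)
    have hd' : HasFDerivAt (fun w => fderiv ℝ v w e) (fderiv ℝ (fun w => fderiv ℝ v w e) z)
        (z + (0 : ℝ) • e) := by simpa using hd.hasFDerivAt
    exact hd'.comp_hasDerivAt 0 (hl 0)

lemma pt_last {n : ℕ} (x : EuclideanSpace ℝ (Fin n)) (y : ℝ) : ycoord (pt x y) = y := by
  simp [ycoord, pt]

lemma pt_add {n : ℕ} (x : EuclideanSpace ℝ (Fin n)) (y t : ℝ) :
    pt x y + t • eY n = pt x (y + t) := by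
  ext i
  refine Fin.lastCases ?_ (fun j => ?_) i
  · simp [pt, eY]
  · simp [pt, eY]

def xpart {n : ℕ} (z : E n) : EuclideanSpace ℝ (Fin n) :=
  (EuclideanSpace.equiv (Fin n) ℝ).symm (fun i => z i.castSucc)

lemma pt_xpart {n : ℕ} (z : E n) : pt (xpart z) (ycoord z) = z := by
  ext i
  refine Fin.lastCases ?_ (fun j => ?_) i
  · simp [pt, ycoord]
  · simp [pt, xpart]

lemma norm_xpart_le {n : ℕ} (z : E n) : ‖xpart z‖ ≤ ‖z‖ := by
  rw [EuclideanSpace.norm_eq, EuclideanSpace.norm_eq]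
  apply Real.sqrt_le_sqrt
  rw [Fin.sum_univ_castSucc (n := n)]
  simp [xpart]
  positivity

lemma continuous_pt {n : ℕ} (y : ℝ) : Continuous (fun x : EuclideanSpace ℝ (Fin n) => pt x y) := by
  unfold pt
  refine (EuclideanSpace.equiv (Fin (n + 1)) ℝ).symm.continuous.comp ?_
  refine continuous_pi fun i => ?_
  refine Fin.lastCases ?_ (fun j => ?_) i
  · simp; fun_prop
  · simp; fun_prop

/-- monotonicity in y of `v / y^α` -/
lemma mono_u {n : ℕ} (α : ℝ) (hα : 0 < α) (v : E n → ℝ) (hpos : ∀ z ∈ upperHalf n, 0 < v z)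
    (hC2 : ContDiffOn ℝ 2 v (upperHalf n))
    (hgrad : ∀ z ∈ upperHalf n,
      ycoord z * ‖gradient (fun z => (v z) ^ (1 / α)) z‖ ≤ (v z) ^ (1 / α))
    (x : EuclideanSpace ℝ (Fin n)) :
    AntitoneOn (fun y : ℝ => v (pt x y) / y ^ α) (Ioi 0) := by
  have hmem : ∀ y : ℝ, 0 < y → pt x y ∈ upperHalf n := fun y hy => by
    simpa [upperHalf, pt_last] using hy
  set ρ : E n → ℝ := fun z => (v z) ^ (1 / α) with hρ
  have hd : ∀ y : ℝ, 0 < y → HasDerivAt (fun y => ρ (pt x y)) (fderiv ℝ ρ (pt x y) (eY n)) y := by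
    intro y hy
    have h1 : DifferentiableAt ℝ ρ (pt x y) := by
      have : DifferentiableAt ℝ v (pt x y) :=
        (hC2.contDiffAt ((isOpen_upperHalf n).mem_nhds (hmem y hy))).differentiableAt (by norm_num)
      exact this.rpow_const (Or.inl (hpos _ (hmem y hy)).ne')
    have hl : HasDerivAt (fun t : ℝ => pt x t) (eY n) y := by
      have : (fun t : ℝ => pt x t) = fun t => pt x 0 + t • eY n := by
        funext t; rw [pt_add]; simp
      rw [this]
      simpa using ((hasDerivAt_id y).smul_const (eY n)).const_add (pt x 0)
    exact h1.hasFDerivAt.comp_hasDerivAt y hl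
  have hle : ∀ y : ℝ, 0 < y → y * fderiv ℝ ρ (pt x y) (eY n) ≤ ρ (pt x y) := by
    intro y hy
    have h := hgrad _ (hmem y hy)
    rw [pt_last] at h
    refine le_trans (mul_le_mul_of_nonneg_left ?_ hy.le) h
    have h2 := (fderiv ℝ ρ (pt x y)).le_opNorm (eY n)
    have h3 : ‖eY n‖ = 1 := by simp [eY]
    have h4 : ‖gradient ρ (pt x y)‖ = ‖fderiv ℝ ρ (pt x y)‖ := by simp [gradient]
    rw [h3, mul_one] at h2
    rw [h4]
    exact (le_abs_self _).trans h2
  have hq : AntitoneOn (fun y : ℝ => ρ (pt x y) / y) (Ioi 0) := by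
    have hder : ∀ y : ℝ, 0 < y → HasDerivAt (fun y : ℝ => ρ (pt x y) / y)
        ((fderiv ℝ ρ (pt x y) (eY n) * y - ρ (pt x y) * 1) / y ^ 2) y := fun y hy =>
      (hd y hy).div (hasDerivAt_id y) hy.ne'
    apply antitoneOn_of_deriv_nonpos (convex_Ioi 0)
    · exact fun y hy => (hder y hy).continuousAt.continuousWithinAt
    · intro y hy
      rw [interior_Ioi] at hy
      exact (hder y hy).differentiableAt.differentiableWithinAt
    · intro y hy
      rw [interior_Ioi] at hy
      rw [(hder y hy).deriv]
      apply div_nonpos_of_nonpos_of_nonneg _ (sq_nonneg y)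
      have := hle y hy
      linarith
  have key : ∀ y : ℝ, 0 < y → v (pt x y) / y ^ α = (ρ (pt x y) / y) ^ α := by
    intro y hy
    have hv := hpos _ (hmem y hy)
    rw [Real.div_rpow (by positivity) hy.le, hρ]
    simp only
    rw [← Real.rpow_mul hv.le, one_div_mul_cancel hα.ne', Real.rpow_one]
  intro a ha b hb hab
  simp only
  rw [key a ha, key b hb]
  have hb' : (0 : ℝ) < b := hb
  exact Real.rpow_le_rpow (div_nonneg (Real.rpow_nonneg (hpos _ (hmem b hb)).le _) hb'.le)
    (hq ha hb hab) hα.le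

lemma norm_sq_slice {n : ℕ} (z : E n) (i : Fin (n + 1)) (t : ℝ) :
    ‖z + t • (EuclideanSpace.single i (1 : ℝ) : E n)‖ ^ 2 = ‖z‖ ^ 2 + 2 * t * z i + t ^ 2 := by
  rw [norm_add_sq_real, inner_smul_right, norm_smul, EuclideanSpace.inner_single_right]
  simp
  ring

/-- The barrier-corrected quotient has no interior local minimum. -/
lemma no_min {n : ℕ} (α : ℝ) (hαn : 2 * α - n + 1 ≤ 0)
    (v : E n → ℝ) (hC2 : ContDiffOn ℝ 2 v (upperHalf n)) (z : E n) (hz : z ∈ upperHalf n)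
    (hpde : (ycoord z) ^ 2 * lap v z - ((n : ℝ) - 1) * ycoord z * partialY v z +
        ((n : ℝ) - α) * α * v z = 0)
    (c K : ℝ) (hc : 0 ≤ c) (hK : 0 ≤ K)
    (hcK : 2 * c * (n + 1) < K / 4 * (ycoord z) ^ (-(3 / 2) : ℝ))
    (hmin : IsLocalMin (fun z : E n => v z * (ycoord z) ^ (-α) + c * ‖z‖ ^ 2
      + K * (ycoord z) ^ (1 / 2 : ℝ)) z) : False := by
  have hy : 0 < ycoord z := hz
  set y := ycoord z with hydef
  have hslmin : ∀ e : E n, IsLocalMin (fun t : ℝ => v (z + t • e) * (ycoord (z + t • e)) ^ (-α)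
      + c * ‖z + t • e‖ ^ 2 + K * (ycoord (z + t • e)) ^ (1 / 2 : ℝ)) 0 := by
    intro e
    have hc : ContinuousAt (fun t : ℝ => z + t • e) 0 := by fun_prop
    have hm : IsLocalMin (fun z : E n => v z * (ycoord z) ^ (-α) + c * ‖z‖ ^ 2
      + K * (ycoord z) ^ (1 / 2 : ℝ)) (z + (0 : ℝ) • e) := by simpa using hmin
    exact IsMinFilter.comp_tendsto (g := fun t : ℝ => z + t • e) hm hc
  have hx : ∀ j : Fin n, 0 ≤ fderiv ℝ (fun w => fderiv ℝ v w
      (EuclideanSpace.single j.castSucc (1 : ℝ))) z (EuclideanSpace.single j.castSucc (1 : ℝ))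
        * y ^ (-α) + 2 * c := by
    intro j
    set e : E n := EuclideanSpace.single j.castSucc (1 : ℝ) with he
    obtain ⟨h1, h2, h3⟩ := slice_derivs v hC2 z hz e
    have hm := hslmin e
    have hyc : ∀ t : ℝ, ycoord (z + t • e) = y := by
      intro t
      simp [hydef, ycoord, he]
    simp only [hyc] at hm
    simp only [he, norm_sq_slice] at hm
    rw [← he] at hm
    refine (second_test _ (fun t => fderiv ℝ v (z + t • e) e * y ^ (-α)
      + c * (2 * z j.castSucc + 2 * t)) _ 0 ?_ ?_ hm).2
    · filter_upwards [h2] with t ht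
      have hp : HasDerivAt (fun t : ℝ => ‖z‖ ^ 2 + 2 * t * z j.castSucc + t ^ 2)
          (2 * z j.castSucc + 2 * t) t := by
        have := (((hasDerivAt_id t).const_mul 2).mul_const (z j.castSucc)).const_add (‖z‖ ^ 2)
        have h5 := this.add ((hasDerivAt_id t).pow 2)
        refine (h5.congr_deriv ?_)
        simp
      exact (((h1 t ht).mul_const _).add (hp.const_mul c)).add_const _
    · have hp : HasDerivAt (fun t : ℝ => c * (2 * z j.castSucc + 2 * t)) (2 * c) 0 := by
        have := (((hasDerivAt_id (0 : ℝ)).const_mul 2).const_add (2 * z j.castSucc)).const_mul c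
        refine this.congr_deriv ?_
        ring
      exact (h3.mul_const _).add hp
  have hlast : fderiv ℝ v z (eY n) * y ^ (-α) + v z * (-α * y ^ (-α - 1)) + c * (2 * y)
        + K * (1 / 2 * y ^ (1 / 2 - 1 : ℝ)) = 0 ∧
      0 ≤ (fderiv ℝ (fun w => fderiv ℝ v w (eY n)) z (eY n)) * y ^ (-α)
        + fderiv ℝ v z (eY n) * (-α * y ^ (-α - 1))
        + (fderiv ℝ v z (eY n) * (-α * y ^ (-α - 1))
          + v z * (-α * ((-α - 1) * y ^ (-α - 1 - 1)))) + 2 * c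
        + K * (1 / 2 * ((1 / 2 - 1) * y ^ (1 / 2 - 1 - 1 : ℝ))) := by
    obtain ⟨h1, h2, h3⟩ := slice_derivs v hC2 z hz (eY n)
    have hm := hslmin (eY n)
    have hyc : ∀ t : ℝ, ycoord (z + t • eY n) = y + t := by
      intro t
      simp [hydef, ycoord, eY]
    simp only [hyc] at hm
    have hns : ∀ t : ℝ, ‖z + t • eY n‖ ^ 2 = ‖z‖ ^ 2 + 2 * t * y + t ^ 2 :=
      fun t => norm_sq_slice z (Fin.last n) t
    simp only [hns] at hm
    have hpw : ∀ p t : ℝ, 0 < y + t →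
        HasDerivAt (fun t : ℝ => (y + t) ^ p) (p * (y + t) ^ (p - 1)) t := by
      intro p t ht
      have := ((hasDerivAt_id t).const_add y).rpow_const (p := p) (Or.inl ht.ne')
      refine this.congr_deriv ?_
      simp
    have hyt : ∀ t : ℝ, z + t • eY n ∈ upperHalf n → 0 < y + t := by
      intro t ht
      rw [← hyc]; exact ht
    have := second_test _ (fun t => fderiv ℝ v (z + t • eY n) (eY n) * (y + t) ^ (-α)
      + v (z + t • eY n) * (-α * (y + t) ^ (-α - 1))
      + c * (2 * y + 2 * t) + K * (1 / 2 * (y + t) ^ (1 / 2 - 1 : ℝ)))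
      ((fderiv ℝ (fun w => fderiv ℝ v w (eY n)) z (eY n)) * y ^ (-α)
        + fderiv ℝ v z (eY n) * (-α * y ^ (-α - 1))
        + (fderiv ℝ v z (eY n) * (-α * y ^ (-α - 1))
          + v z * (-α * ((-α - 1) * y ^ (-α - 1 - 1)))) + 2 * c
        + K * (1 / 2 * ((1 / 2 - 1) * y ^ (1 / 2 - 1 - 1 : ℝ)))) 0 ?_ ?_ hm
    · refine ⟨?_, this.2⟩
      have h := this.1
      simp only [zero_smul, add_zero, mul_zero] at h
      exact h
    · filter_upwards [h2] with t ht
      have hp : HasDerivAt (fun t : ℝ => ‖z‖ ^ 2 + 2 * t * y + t ^ 2)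
          (2 * y + 2 * t) t := by
        have := (((hasDerivAt_id t).const_mul 2).mul_const y).const_add (‖z‖ ^ 2)
        have h5 := this.add ((hasDerivAt_id t).pow 2)
        refine (h5.congr_deriv ?_)
        simp
      exact (((h1 t ht).mul (hpw _ t (hyt t ht))).add (hp.const_mul c)).add
        ((hpw _ t (hyt t ht)).const_mul K)
    · have hp : HasDerivAt (fun t : ℝ => c * (2 * y + 2 * t)) (2 * c) 0 := by
        have := (((hasDerivAt_id (0 : ℝ)).const_mul 2).const_add (2 * y)).const_mul c
        refine this.congr_deriv ?_
        ring
      have hy0 : 0 < y + 0 := by simpa using hy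
      have hv0 := h1 0 (by simpa using hz)
      have := (((h3.mul (hpw (-α) 0 hy0)).add
        (hv0.mul ((hpw (-α - 1) 0 hy0).const_mul (-α)))).add hp).add
        (((hpw (1 / 2 - 1) 0 hy0).const_mul (1 / 2)).const_mul K)
      refine this.congr_deriv ?_
      simp only [zero_smul, add_zero]
  obtain ⟨hg1, hg2⟩ := hlast
  have hsum : 0 ≤ (lap v z - fderiv ℝ (fun w => fderiv ℝ v w (eY n)) z (eY n)) * y ^ (-α)
      + n * (2 * c) := by
    have h := Finset.sum_nonneg (s := Finset.univ) fun j _ => hx j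
    rw [Finset.sum_add_distrib, ← Finset.sum_mul] at h
    simp only [Finset.sum_const, Finset.card_univ, Fintype.card_fin, nsmul_eq_mul] at h
    have hl : lap v z = (∑ j : Fin n, fderiv ℝ (fun w => fderiv ℝ v w
      (EuclideanSpace.single j.castSucc (1 : ℝ))) z (EuclideanSpace.single j.castSucc (1 : ℝ)))
        + fderiv ℝ (fun w => fderiv ℝ v w (eY n)) z (eY n) := by
      unfold lap
      rw [Fin.sum_univ_castSucc]
      rfl
    rw [hl]
    simpa using h
  unfold partialY at hpde
  generalize fderiv ℝ (fun w => fderiv ℝ v w (eY n)) z (eY n) = Dyy at *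
  generalize fderiv ℝ v z (eY n) = D at *
  generalize lap v z = L at *
  generalize v z = V at *
  have e1 : y ^ (-α - 1) = y ^ (-α) / y := by rw [Real.rpow_sub_one hy.ne']
  have e2 : y ^ (-α - 1 - 1) = y ^ (-α) / y / y := by
    rw [Real.rpow_sub_one hy.ne', Real.rpow_sub_one hy.ne']
  have e3 : y ^ (1 / 2 - 1 - 1 : ℝ) = y ^ (-(3 / 2) : ℝ) := by norm_num
  have e4 : y ^ (1 / 2 - 1 : ℝ) = y ^ (-(3 / 2) : ℝ) * y := by
    rw [← Real.rpow_add_one hy.ne']; norm_num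
  rw [e1, e4] at hg1
  rw [e1, e2, e3] at hg2
  have hP : 0 < y ^ (-(3 / 2) : ℝ) := Real.rpow_pos_of_pos hy _
  generalize y ^ (-(3 / 2) : ℝ) = P at *
  generalize y ^ (-α) = Y at *
  have hL : L = ((n - 1) * y * D - (n - α) * α * V) / y ^ 2 := by
    field_simp; linarith
  have hD : Y * (D - α * V / y) = - (2 * c * y + K / 2 * P * y) := by
    have : D * Y + V * (-α * (Y / y)) = Y * (D - α * V / y) := by ring
    linarith
  have hid : L * Y + D * (-α * (Y / y)) + (D * (-α * (Y / y))
      + V * (-α * ((-α - 1) * (Y / y / y)))) = (n - 1 - 2 * α) / y * (Y * (D - α * V / y)) := by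
    rw [hL]; field_simp; ring
  rw [hD] at hid
  have hneg : (n - 1 - 2 * α) / y * (- (2 * c * y + K / 2 * P * y)) ≤ 0 := by
    apply mul_nonpos_of_nonneg_of_nonpos
    · apply div_nonneg _ hy.le; linarith
    · have : 0 ≤ 2 * c * y + K / 2 * P * y := by positivity
      linarith
  nlinarith

/-- Comparison with the barrier. -/
lemma barrier {n : ℕ} (α : ℝ) (hα : 0 < α) (hαn : 2 * α - n + 1 ≤ 0)
    (v : E n → ℝ) (hpos : ∀ z ∈ upperHalf n, 0 < v z)
    (hC2 : ContDiffOn ℝ 2 v (upperHalf n))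
    (hpde : ∀ z ∈ upperHalf n, (ycoord z) ^ 2 * lap v z
      - ((n : ℝ) - 1) * ycoord z * partialY v z + ((n : ℝ) - α) * α * v z = 0)
    (hmono : ∀ x : EuclideanSpace ℝ (Fin n), AntitoneOn (fun y : ℝ => v (pt x y) / y ^ α) (Ioi 0))
    (hlim : ∀ x : EuclideanSpace ℝ (Fin n),
      Tendsto (fun y => v (pt x y) / y ^ α) (𝓝[>] 0) (𝓝 1))
    (R : ℝ) (hR : 0 < R) (z : E n) (hz : z ∈ upperHalf n) (hzR : ‖z‖ < R) :
    1 ≤ v z / (ycoord z) ^ α + 1 / R ^ 2 * ‖z‖ ^ 2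
      + (8 * (n + 1) + 1) * R ^ (-(1 / 2) : ℝ) * (ycoord z) ^ (1 / 2 : ℝ) := by
  set c : ℝ := 1 / R ^ 2 with hcdef
  set K : ℝ := (8 * (n + 1) + 1) * R ^ (-(1 / 2) : ℝ) with hKdef
  have hc : 0 < c := by positivity
  have hK : 0 < K := by positivity
  have hdivmul : ∀ w ∈ upperHalf n, v w / (ycoord w) ^ α = v w * (ycoord w) ^ (-α) := by
    intro w hw
    rw [Real.rpow_neg (le_of_lt hw)]; rfl
  set Φ : E n → ℝ := fun z : E n => v z * (ycoord z) ^ (-α) + c * ‖z‖ ^ 2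
      + K * (ycoord z) ^ (1 / 2 : ℝ) with hΦ
  rw [hdivmul z hz]
  change 1 ≤ Φ z
  by_contra hlt
  push Not at hlt
  have hycont : Continuous (fun z : E n => ycoord z) := by unfold ycoord; fun_prop
  have hucont : ContinuousOn (fun z : E n => v z * (ycoord z) ^ (-α)) (upperHalf n) :=
    hC2.continuousOn.mul
      (hycont.continuousOn.rpow_const fun w hw => Or.inl (ne_of_gt hw))
  have hΦcont : ContinuousOn Φ (upperHalf n) := by
    refine (hucont.add (by fun_prop)).add (continuousOn_const.mul ?_)
    exact hycont.continuousOn.rpow_const fun w hw => Or.inl (ne_of_gt hw)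
  -- Dini
  have hεpos : ∀ k : ℕ, (0 : ℝ) < 1 / ((k : ℝ) + 1) := fun k => by positivity
  have hptmem : ∀ (x : EuclideanSpace ℝ (Fin n)) (y : ℝ), 0 < y → pt x y ∈ upperHalf n := by
    intro x y hy
    simpa [upperHalf, pt_last] using hy
  have hεlim : Tendsto (fun k : ℕ => 1 / ((k : ℝ) + 1)) atTop (𝓝[>] 0) := by
    rw [tendsto_nhdsWithin_iff]
    exact ⟨tendsto_one_div_add_atTop_nhds_zero_nat, Eventually.of_forall hεpos⟩
  have hdini : TendstoUniformlyOn (fun (k : ℕ) (x : EuclideanSpace ℝ (Fin n)) =>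
      v (pt x (1 / ((k : ℝ) + 1))) / (1 / ((k : ℝ) + 1)) ^ α) (fun _ => (1 : ℝ)) atTop
      (Metric.closedBall 0 R) := by
    apply Monotone.tendstoUniformlyOn_of_forall_tendsto (isCompact_closedBall 0 R)
    · intro k
      refine ContinuousOn.div_const ?_ _
      exact hC2.continuousOn.comp (continuous_pt _).continuousOn fun x _ => hptmem x _ (hεpos k)
    · intro x _ k l hkl
      refine hmono x (hεpos l) (hεpos k) ?_
      apply one_div_le_one_div_of_le (by positivity)
      have : (k : ℝ) ≤ l := by exact_mod_cast hkl
      linarith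
    · exact continuousOn_const
    · intro x _
      exact (hlim x).comp hεlim
  have hev1 := (Metric.tendstoUniformlyOn_iff.1 hdini) (1 - Φ z) (by linarith)
  have hev2 : ∀ᶠ k : ℕ in atTop, 1 / ((k : ℝ) + 1) < ycoord z :=
    tendsto_one_div_add_atTop_nhds_zero_nat.eventually_lt_const hz
  obtain ⟨k, hk1, hk2⟩ := (hev1.and hev2).exists
  have hε := hεpos k
  set ε : ℝ := 1 / ((k : ℝ) + 1) with hεdef
  let S : Set (E n) := Metric.closedBall 0 R ∩ {w | ε ≤ ycoord w}
  have hS : IsCompact S :=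
    (isCompact_closedBall 0 R).inter_right (isClosed_le continuous_const hycont)
  have hSU : S ⊆ upperHalf n := fun w hw => lt_of_lt_of_le hε hw.2
  have hzS : z ∈ S := ⟨by simpa using hzR.le, hk2.le⟩
  obtain ⟨m, hmS, hm⟩ := hS.exists_isMinOn ⟨z, hzS⟩ (hΦcont.mono hSU)
  have hmz : Φ m ≤ Φ z := hm hzS
  have hmU := hSU hmS
  have hmy : 0 < ycoord m := hmU
  have hv0 := hpos m hmU
  have hmR : ‖m‖ < R := by
    have h1 : ‖m‖ ≤ R := by simpa using hmS.1
    refine lt_of_le_of_ne h1 fun h => ?_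
    have h2 : (1 : ℝ) ≤ Φ m := by
      have h3 : c * ‖m‖ ^ 2 = 1 := by rw [h, hcdef]; field_simp
      have h4 : 0 ≤ v m * (ycoord m) ^ (-α) := by positivity
      have h5 : 0 ≤ K * (ycoord m) ^ (1 / 2 : ℝ) := by positivity
      simp only [hΦ]
      linarith
    linarith
  have hmε : ε < ycoord m := by
    refine lt_of_le_of_ne hmS.2 fun h => ?_
    have h1 := hk1 (xpart m) (by
      simpa using (norm_xpart_le m).trans hmR.le)
    rw [h, pt_xpart, hdivmul m hmU, Real.dist_eq] at h1
    have h2 := (abs_lt.1 h1).2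
    have h3 : 0 ≤ c * ‖m‖ ^ 2 := by positivity
    have h5 : 0 ≤ K * (ycoord m) ^ (1 / 2 : ℝ) := by positivity
    have h6 : Φ m = v m * (ycoord m) ^ (-α) + c * ‖m‖ ^ 2
      + K * (ycoord m) ^ (1 / 2 : ℝ) := rfl
    linarith
  have hlocal : IsLocalMin Φ m := by
    apply hm.isLocalMin
    have ho : IsOpen (Metric.ball (0 : E n) R ∩ {w | ε < ycoord w}) :=
      Metric.isOpen_ball.inter (isOpen_lt continuous_const hycont)
    refine mem_of_superset (ho.mem_nhds ⟨by simpa using hmR, hmε⟩) ?_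
    exact inter_subset_inter Metric.ball_subset_closedBall (fun w (hw : ε < ycoord w) => hw.le)
  refine no_min α hαn v hC2 m hmU (hpde m hmU) c K hc.le hK.le ?_ hlocal
  have hyR : ycoord m ≤ R := by
    have h1 : |m (Fin.last n)| ≤ ‖m‖ := by
      simpa using PiLp.norm_apply_le m (Fin.last n)
    exact (le_abs_self _).trans (h1.trans hmR.le)
  have hpw : R ^ (-(3 / 2) : ℝ) ≤ (ycoord m) ^ (-(3 / 2) : ℝ) :=
    Real.rpow_le_rpow_of_nonpos hmy hyR (by norm_num)
  have hRR : R ^ (-(1 / 2) : ℝ) * R ^ (-(3 / 2) : ℝ) = c := by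
    rw [← Real.rpow_add hR, hcdef]
    norm_num
  calc 2 * c * (n + 1) < (8 * (n + 1) + 1) / 4 * c := by nlinarith
    _ = K / 4 * R ^ (-(3 / 2) : ℝ) := by rw [← hRR, hKdef]; ring
    _ ≤ _ := by gcongr

/-- Liouville-type theorem for adapted metrics with `γ ∈ [1/2, n/2)`:
if `w = 1 - v/y^{n-s} ∈ H̃^{1,0}`, vanishes on the boundary, and the scalar curvature
of the adapted metric is nonnegative (i.e. `y|∇ρ| ≤ ρ`), then `v = y^{n-s}`. -/
theorem liouville_adapted_metric_mid_gamma
    (n : ℕ) (hn : 2 ≤ n) (γ : ℝ) (hγ : γ ∈ Set.Ico (1 / 2 : ℝ) ((n : ℝ) / 2))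
    (s : ℝ) (hs : s = (n : ℝ) / 2 + γ)
    (v : E n → ℝ) (hpos : ∀ z ∈ upperHalf n, 0 < v z)
    (hC2 : ContDiffOn ℝ 2 v (upperHalf n))
    (hpde : ∀ z ∈ upperHalf n,
      (ycoord z) ^ 2 * lap v z - ((n : ℝ) - 1) * ycoord z * partialY v z +
        s * ((n : ℝ) - s) * v z = 0)
    (w : E n → ℝ) (hw : ∀ z ∈ upperHalf n, w z = 1 - v z / (ycoord z) ^ ((n : ℝ) - s))
    (hmem : memH1T n 0 w)
    (hlim : ∀ x : EuclideanSpace ℝ (Fin n),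
      Tendsto (fun y => w (pt x y)) (nhdsWithin 0 (Set.Ioi 0)) (nhds 0))
    (hgrad : ∀ z ∈ upperHalf n,
      ycoord z * ‖gradient (fun z => (v z) ^ (1 / ((n : ℝ) - s))) z‖ ≤
        (v z) ^ (1 / ((n : ℝ) - s))) :
    ∀ z ∈ upperHalf n, v z = (ycoord z) ^ ((n : ℝ) - s) := by
  obtain ⟨hγ1, hγ2⟩ := hγ
  obtain ⟨α, hα⟩ : ∃ α : ℝ, α = (n : ℝ) - s := ⟨_, rfl⟩
  have hs' : s = n - α := by linarith
  have hα0 : 0 < α := by linarith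
  have hαn : 2 * α - n + 1 ≤ 0 := by linarith
  rw [← hα] at hpde hgrad hw ⊢
  rw [hs'] at hpde
  have hmono := mono_u α hα0 v hpos hC2 hgrad
  have hptmem : ∀ (x : EuclideanSpace ℝ (Fin n)) (y : ℝ), 0 < y → pt x y ∈ upperHalf n := by
    intro x y hy
    simpa [upperHalf, pt_last] using hy
  have hlim' : ∀ x : EuclideanSpace ℝ (Fin n),
      Tendsto (fun y => v (pt x y) / y ^ α) (𝓝[>] 0) (𝓝 1) := by
    intro x
    have h := (hlim x).const_sub 1
    rw [sub_zero] at h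
    refine h.congr' ?_
    filter_upwards [self_mem_nhdsWithin] with y hy
    rw [hw _ (hptmem x y hy), pt_last]
    ring
  intro z hz
  have hy : 0 < ycoord z := hz
  have hle : v z / (ycoord z) ^ α ≤ 1 := by
    refine ge_of_tendsto (hlim' (xpart z)) ?_
    filter_upwards [self_mem_nhdsWithin, mem_nhdsWithin_of_mem_nhds (Iio_mem_nhds hy)] with y h1 h2
    have := hmono (xpart z) h1 hy (le_of_lt h2)
    simpa only [pt_xpart] using this
  have hge : 1 ≤ v z / (ycoord z) ^ α := by
    have ht : Tendsto (fun R : ℝ => v z / (ycoord z) ^ α + 1 / R ^ 2 * ‖z‖ ^ 2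
      + (8 * (n + 1) + 1) * R ^ (-(1 / 2) : ℝ) * (ycoord z) ^ (1 / 2 : ℝ)) atTop
      (𝓝 (v z / (ycoord z) ^ α + 0 * ‖z‖ ^ 2
      + (8 * (n + 1) + 1) * 0 * (ycoord z) ^ (1 / 2 : ℝ))) := by
      have h1 : Tendsto (fun R : ℝ => 1 / R ^ 2) atTop (𝓝 0) := by
        simpa using tendsto_pow_neg_atTop (𝕜 := ℝ) (n := 2) (by norm_num)
      have h2 : Tendsto (fun R : ℝ => R ^ (-(1 / 2) : ℝ)) atTop (𝓝 0) :=
        tendsto_rpow_neg_atTop (by norm_num)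
      exact ((h1.mul_const _).const_add _).add ((h2.const_mul _).mul_const _)
    rw [zero_mul, mul_zero, zero_mul, add_zero, add_zero] at ht
    refine ge_of_tendsto ht ?_
    filter_upwards [eventually_gt_atTop ‖z‖] with R hR
    exact barrier α hα0 hαn v hpos hC2 hpde hmono hlim' R ((norm_nonneg z).trans_lt hR) z hz hR
  have h1 := le_antisymm hle hge
  rwa [div_eq_one_iff_eq (Real.rpow_pos_of_pos hy α).ne'] at h1

end
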